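/- Let R be a commutative Noetherian ring, n ≥ 1, M a (2n+1)×(2n+1) alternating matrix over R such that the ideal Pf(M) of submaximal Pfaffians has grade 3, and let i₀ be an index. If r ∈ R satisfies r · Pf_{i₀}(M) ∈ (Pf_j(M) : j ≠ i₀), then r lies in the ideal generated by the entries of the i₀-th row of M. In particular, if all entries of the i₀-th row of M lie in an ideal im(x) ⊆ R, then the colon ideal ((Pf_j(M) : j ≠ i₀) :_R Pf_{i₀}(M)) is contained in im(x). -/

import Mathlib

open MvPolynomial Module

noncomputable section

/-- The standard graded polynomial ring `k[x_1, …, x_n]` (each variable of degree 1). -/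
abbrev MvP (n : ℕ) (k : Type) [Field k] := MvPolynomial (Fin n) k

variable {n : ℕ} {k : Type} [Field k]

/-- The irrelevant ideal `R₊ = (x_1, …, x_n)`. -/
def irrIdeal (n : ℕ) (k : Type) [Field k] : Ideal (MvP n k) :=
  Ideal.span (Set.range X)

/-- A homogeneous ideal (w.r.t. the standard grading). -/
def IsHomogIdeal (I : Ideal (MvP n k)) : Prop :=
  ∀ f ∈ I, ∀ j : ℕ, homogeneousComponent j f ∈ I

/-- `gradeGE I m` : the ideal `I` contains an `R`-regular sequence of length `m`. -/
def gradeGE {R : Type} [CommRing R] (I : Ideal R) (m : ℕ) : Prop :=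
  ∃ rs : List R, rs.length = m ∧ (∀ r ∈ rs, r ∈ I) ∧ RingTheory.Sequence.IsRegular R rs

/-- `hasGrade I m` : the grade (length of a maximal `R`-regular sequence contained in `I`)
is exactly `m`. -/
def hasGrade {R : Type} [CommRing R] (I : Ideal R) (m : ℕ) : Prop :=
  gradeGE I m ∧ ¬ gradeGE I (m + 1)

/-- `mu I` : the minimal number of generators of `I`. -/
def mu {R : Type} [CommRing R] (I : Ideal R) : ℕ :=
  sInf {m | ∃ f : Fin m → R, Ideal.span (Set.range f) = I}

/-- The degree-`j` graded piece of `R/I` (the image of the degree-`j` forms). -/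
def aDeg (I : Ideal (MvP n k)) (j : ℕ) : Submodule k (MvP n k ⧸ I) :=
  Submodule.map (Ideal.Quotient.mkₐ k I).toLinearMap (homogeneousSubmodule (Fin n) k j)

/-- The socle `(0 :_{R/I} R₊)` of `R/I`, as a `k`-subspace of `R/I`. -/
def socle (I : Ideal (MvP n k)) : Submodule k (MvP n k ⧸ I) where
  carrier := {a | ∀ i : Fin n, Ideal.Quotient.mk I (X i) * a = 0}
  add_mem' := by intro a b ha hb i; rw [mul_add, ha i, hb i, add_zero]
  zero_mem' := by intro i; rw [mul_zero]
  smul_mem' := by intro c a ha i; rw [mul_smul_comm, ha i, smul_zero]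

/-- `Soc(R/I) = k(-c)` : the socle is one–dimensional, concentrated in degree `c`.
(For an Artinian quotient this says exactly that `R/I` is Gorenstein with socle degree `c`.) -/
def SocleOne (I : Ideal (MvP n k)) (c : ℕ) : Prop :=
  finrank k (socle I) = 1 ∧ finrank k ↥(socle I ⊓ aDeg I c) = 1

/-- `Soc(R/I) = k(-a) ⊕ k(-b)` : the socle is two–dimensional, with one basis vector in
degree `a` and one in degree `b`. -/
def SocleTwo (I : Ideal (MvP n k)) (a b : ℕ) : Prop :=
  finrank k (socle I) = 2 ∧
    finrank k ↥(socle I ⊓ aDeg I a) = 1 ∧ finrank k ↥(socle I ⊓ aDeg I b) = 1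

/-- A standard graded Artinian algebra `A = R/I` with embedding dimension
`e = dim_k A₁`, top socle degree `s` (the largest `s` with `A_s = 𝔪^s ≠ 0`), and socle
polynomial `∑ cᵢ zⁱ` (where `cᵢ = dim_k (Soc A)ᵢ`) is compressed if
`dim_k Aᵢ = min { C(e-1+i, i), ∑_ℓ c_ℓ · C(e-1+ℓ-i, ℓ-i) }` for all `0 ≤ i ≤ s`. -/
def IsCompressed (I : Ideal (MvP n k)) : Prop :=
  ∃ s : ℕ, aDeg I s ≠ ⊥ ∧ (∀ j, s < j → aDeg I j = ⊥) ∧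
    ∀ i ≤ s,
      finrank k ↥(aDeg I i) =
        min (Nat.choose (finrank k ↥(aDeg I 1) - 1 + i) i)
          (∑ l ∈ Finset.Icc i s,
            finrank k ↥(socle I ⊓ aDeg I l) *
              Nat.choose (finrank k ↥(aDeg I 1) - 1 + (l - i)) (l - i))

/-- The image of `X i` in `R/I`. -/
def xq (I : Ideal (MvP n k)) (i : Fin n) : MvP n k ⧸ I :=
  Ideal.Quotient.mk I (X i)

/-- The Pfaffian of a `2m × 2m` matrix (intended for alternating matrices), defined by
recursive expansion along the first row:
`pf(A) = ∑_j (-1)^j ⬝ A 0 (j+1) ⬝ pf(A with rows/columns 0 and j+1 removed)`. -/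
def pfAux {R : Type} [CommRing R] :
    (m : ℕ) → Matrix (Fin (2 * m)) (Fin (2 * m)) R → R
  | 0, _ => 1
  | (m + 1), A =>
      ∑ j : Fin (2 * m + 1),
        (-1 : R) ^ (j : ℕ) * A 0 j.succ *
          pfAux m (A.submatrix (fun i : Fin (2 * m) => Fin.succ (j.succAbove i))
            (fun i : Fin (2 * m) => Fin.succ (j.succAbove i)))

/-- `subPf M i` : the submaximal Pfaffian `Pf_i(M)` of a `(2m+1) × (2m+1)` (alternating)
matrix `M`: the Pfaffian of the matrix obtained by deleting the `i`-th row and column. -/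
def subPf {R : Type} [CommRing R] {m : ℕ}
    (M : Matrix (Fin (2 * m + 1)) (Fin (2 * m + 1)) R) (i : Fin (2 * m + 1)) : R :=
  pfAux m (M.submatrix i.succAbove i.succAbove)

/-- The ideal `Pf(M)` of submaximal Pfaffians of `M`. -/
def pfIdeal {R : Type} [CommRing R] {m : ℕ}
    (M : Matrix (Fin (2 * m + 1)) (Fin (2 * m + 1)) R) : Ideal R :=
  Ideal.span (Set.range (subPf M))

/-- A matrix is alternating: skew-symmetric with zero diagonal. -/
def IsAlternating {R : Type} [CommRing R] {m : ℕ} (M : Matrix (Fin m) (Fin m) R) : Prop :=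
  M.transpose = -M ∧ ∀ i, M i i = 0

/-- The "trimmed" ideal `(Pf_j(M) : j ≠ i₀) + J · (Pf_{i₀}(M))`. -/
def trimPf {R : Type} [CommRing R] {m : ℕ}
    (M : Matrix (Fin (2 * m + 1)) (Fin (2 * m + 1)) R)
    (i₀ : Fin (2 * m + 1)) (J : Ideal R) : Ideal R :=
  Ideal.span {p | ∃ j ≠ i₀, p = subPf M j} ⊔ J * Ideal.span {subPf M i₀}

/-- The quadratic form of an alternating matrix vanishes. -/
lemma IsAlternating.toBilin'_self {R : Type} [CommRing R] {m : ℕ} {M : Matrix (Fin m) (Fin m) R}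
    (hM : IsAlternating M) (v : Fin m → R) : Matrix.toBilin' M v v = 0 := by
  have hskew : ∀ i j, M j i = -M i j := fun i j => congrFun (congrFun hM.1 i) j
  rw [Matrix.toBilin'_apply, ← Finset.sum_product']
  refine Finset.sum_involution (fun x _ => x.swap) ?_ ?_ ?_ ?_
  · rintro ⟨i, j⟩ -
    simp only [Prod.swap, hskew i j]
    ring
  · rintro ⟨i, j⟩ - hne heq
    obtain rfl : j = i := congrArg Prod.fst heq
    simp [hM.2] at hne
  · simp
  · simp

/-- The Wick functional of an alternating matrix: a linear functional on the exterior algebra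
that turns exterior multiplication by a basis vector into contraction with a row of `M`. -/
lemma IsAlternating.exists_wick {R : Type} [CommRing R] {m : ℕ} {M : Matrix (Fin m) (Fin m) R}
    (hM : IsAlternating M) :
    ∃ φ : ExteriorAlgebra R (Fin m → R) →ₗ[R] R, φ 1 = 1 ∧ ∀ a x,
      φ (ExteriorAlgebra.ι R (Pi.single a 1) * x) =
        φ (CliffordAlgebra.contractLeft (∑ j, M a j • LinearMap.proj j) x) := by
  have h : (-Matrix.toBilin' M).toQuadraticMap =
      (0 : QuadraticForm R (Fin m → R)) - 0 := by
    ext v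
    simp [hM.toBilin'_self]
  have hrow : ∀ a, (∑ j, M a j • LinearMap.proj j : Dual R (Fin m → R)) =
      Matrix.toBilin' M (Pi.single a 1) := by
    intro a
    refine LinearMap.pi_ext' fun j => LinearMap.ext_ring ?_
    simp [Pi.single_apply]
  refine ⟨ExteriorAlgebra.algebraMapInv.toLinearMap ∘ₗ CliffordAlgebra.changeForm h,
    ?_, fun a x => ?_⟩
  · simp [CliffordAlgebra.changeForm_one]
  · have hι : ∀ v : Fin m → R, ExteriorAlgebra.algebraMapInv (CliffordAlgebra.ι 0 v) = (0 : R) :=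
      fun v => by simp [ExteriorAlgebra.algebraMapInv, ← ExteriorAlgebra.ι.eq_1]
    simp only [LinearMap.comp_apply, AlgHom.toLinearMap_apply, ExteriorAlgebra.ι]
    rw [CliffordAlgebra.changeForm_ι_mul, CliffordAlgebra.changeForm_contractLeft, hrow, map_sub,
      map_mul, hι]
    simp

/-- Contraction of a decomposable multivector by a linear form. -/
lemma contractLeft_ιMulti {R V : Type*} [CommRing R] [AddCommGroup V] [Module R V]
    (d : Dual R V) : ∀ {k : ℕ} (v : Fin (k + 1) → V),
    CliffordAlgebra.contractLeft d (ExteriorAlgebra.ιMulti R (k + 1) v) =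
      ∑ j : Fin (k + 1), ((-1) ^ (j : ℕ) * d (v j)) •
        ExteriorAlgebra.ιMulti R k (fun i => v (j.succAbove i))
  | 0, v => by
    rw [ExteriorAlgebra.ιMulti_succ_apply, ExteriorAlgebra.ι,
      CliffordAlgebra.contractLeft_ι_mul]
    simp
  | k + 1, v => by
    rw [ExteriorAlgebra.ιMulti_succ_apply, ExteriorAlgebra.ι,
      CliffordAlgebra.contractLeft_ι_mul, contractLeft_ιMulti d,
      Fin.sum_univ_succ (n := k + 1), Finset.mul_sum, sub_eq_add_neg, ← Finset.sum_neg_distrib]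
    congr 1
    · simp [Matrix.vecTail, Function.comp_def]
    · refine Finset.sum_congr rfl fun j _ => ?_
      rw [ExteriorAlgebra.ιMulti_succ_apply, ExteriorAlgebra.ι]
      simp [Matrix.vecTail, Function.comp_def, pow_succ]

/-- The Pfaffians of the principal minors of `M` are values of its Wick functional. -/
lemma pfAux_submatrix_eq {R : Type} [CommRing R] {N : ℕ} {M : Matrix (Fin N) (Fin N) R}
    {φ : ExteriorAlgebra R (Fin N → R) →ₗ[R] R} (h1 : φ 1 = 1)
    (hφ : ∀ a x, φ (ExteriorAlgebra.ι R (Pi.single a 1) * x) =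
        φ (CliffordAlgebra.contractLeft (∑ j, M a j • LinearMap.proj j) x)) :
    ∀ (m : ℕ) (f : Fin (2 * m) → Fin N),
      pfAux m (M.submatrix f f) =
        φ (ExteriorAlgebra.ιMulti R (2 * m) fun i => Pi.single (f i) 1)
  | 0, f => by simp [pfAux, ExteriorAlgebra.ιMulti_apply, h1]
  | m + 1, f => by
    change _ = φ (ExteriorAlgebra.ιMulti R (2 * m + 1 + 1) fun i => Pi.single (f i) 1)
    rw [ExteriorAlgebra.ιMulti_succ_apply, hφ, contractLeft_ιMulti, map_sum, pfAux]
    refine Finset.sum_congr rfl fun j _ => ?_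
    rw [Matrix.submatrix_submatrix, pfAux_submatrix_eq h1 hφ m, map_smul, smul_eq_mul]
    congr 2
    simp [Matrix.vecTail, Pi.single_apply]

/-- The Pfaffians as syzygies of the rows, together with the alternating matrices of
smaller Pfaffians that give contracting homotopies of the Buchsbaum–Eisenbud complex. -/
lemma IsAlternating.pfaffian_identities {R : Type} [CommRing R] {n : ℕ}
    {M : Matrix (Fin (2 * n + 1)) (Fin (2 * n + 1)) R} (hM : IsAlternating M) :
    let p : Fin (2 * n + 1) → R := fun j => (-1) ^ (j : ℕ) * subPf M j
    M.mulVec p = 0 ∧ ∀ i, ∃ B : Matrix (Fin (2 * n + 1)) (Fin (2 * n + 1)) R,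
      B.transpose = -B ∧ M * B = p i • (1 : Matrix _ _ R) - Matrix.vecMulVec (Pi.single i 1) p := by
  intro p
  obtain ⟨φ, h1, hφ⟩ := hM.exists_wick
  set ω : ExteriorAlgebra R (Fin (2 * n + 1) → R) :=
    ExteriorAlgebra.ιMulti R (2 * n + 1) fun i => Pi.single i 1 with hω
  let D : Fin (2 * n + 1) → ExteriorAlgebra R (Fin (2 * n + 1) → R) →ₗ[R] _ := fun j =>
    CliffordAlgebra.contractLeft (Q := (0 : QuadraticForm R (Fin (2 * n + 1) → R)))
      (LinearMap.proj j : Dual R (Fin (2 * n + 1) → R))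
  have hp : ∀ j, φ (D j ω) = p j := by
    intro j
    simp only [D, p, hω]
    rw [contractLeft_ιMulti, map_sum, Finset.sum_eq_single j]
    · simp [subPf, pfAux_submatrix_eq h1 hφ]
    · intro i _ hij
      simp [hij.symm]
    · simp
  have hrow : ∀ a x, ∑ j, M a j * φ (D j x) = φ (ExteriorAlgebra.ι R (Pi.single a 1) * x) := by
    intro a x
    simp [hφ, D]
  have hωmul : ∀ a : Fin (2 * n + 1), ExteriorAlgebra.ι R (Pi.single a (1 : R)) * ω = 0 := by
    intro a
    have : ExteriorAlgebra.ιMulti R (2 * n + 1 + 1)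
        (Fin.cons (Pi.single a (1 : R)) fun i => Pi.single i (1 : R) :
          Fin (2 * n + 1 + 1) → Fin (2 * n + 1) → R) = 0 := by
      apply ExteriorAlgebra.ιMulti_eq_zero_of_not_inj
      intro hinj
      have := @hinj 0 a.succ (by simp)
      exact absurd this (Fin.succ_ne_zero a).symm
    rw [ExteriorAlgebra.ιMulti_succ_apply] at this
    exact this
  have hD : ∀ a k x, ExteriorAlgebra.ι R (Pi.single a (1 : R)) * D k x =
      (Pi.single a (1 : R) : Fin (2 * n + 1) → R) k • x -
        D k (ExteriorAlgebra.ι R (Pi.single a (1 : R)) * x) := by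
    intro a k x
    simp only [D, ExteriorAlgebra.ι]
    rw [CliffordAlgebra.contractLeft_ι_mul]
    simp
  refine ⟨?_, fun i => ⟨Matrix.of fun j k => φ (D j (D k (D i ω))), ?_, ?_⟩⟩
  · ext a
    simp [Matrix.mulVec, dotProduct, ← hp, hrow, hωmul]
  · ext j k
    simp only [Matrix.transpose_apply, Matrix.of_apply, Matrix.neg_apply, D]
    rw [CliffordAlgebra.contractLeft_comm, map_neg]
  · ext l k
    simp only [Matrix.mul_apply, Matrix.of_apply, hrow, hD, hωmul, map_sub, map_smul, map_zero,
      hp, Matrix.sub_apply, Matrix.smul_apply, Matrix.one_apply, Matrix.vecMulVec_apply,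
      Pi.single_apply, smul_eq_mul, sub_zero]
    simp only [eq_comm (a := k), eq_comm (a := i)]
    ring

/-- The elements of a weakly regular sequence of length three, spelled out. -/
lemma exists_regular_of_gradeGE_three {R : Type} [CommRing R] {I : Ideal R} (h : gradeGE I 3) :
    ∃ a ∈ I, ∃ b ∈ I, ∃ c ∈ I, (∀ x, a * x = 0 → x = 0) ∧
      (∀ x y, b * x = a * y → ∃ z, x = a * z) ∧
      ∀ x y z, c * x = a * y + b * z → ∃ s t, x = a * s + b * t := by
  obtain ⟨rs, hlen, hmem, hreg⟩ := h
  obtain ⟨a, b, c, rfl⟩ := List.length_eq_three.mp hlen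
  have hw := hreg.toIsWeaklyRegular.regular_mod_prev
  have key : ∀ (i : ℕ) (hi : i < [a, b, c].length) (x : R),
      [a, b, c][i] * x ∈ Ideal.ofList ([a, b, c].take i) →
        x ∈ Ideal.ofList ([a, b, c].take i) := by
    intro i hi x hx
    have h0 := isSMulRegular_iff_right_eq_zero_of_smul.mp (hw i hi) (Submodule.Quotient.mk x)
    rw [← Submodule.Quotient.mk_smul, Submodule.Quotient.mk_eq_zero,
      Submodule.Quotient.mk_eq_zero] at h0
    simpa using h0 (by simpa using hx)
  refine ⟨a, hmem a (by simp), b, hmem b (by simp), c, hmem c (by simp), ?_, ?_, ?_⟩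
  · intro x hx
    simpa using key 0 (by simp) x (by simp [hx])
  · intro x y hxy
    have := key 1 (by simp) x (by
      simpa [Ideal.ofList_singleton, Ideal.mem_span_singleton] using ⟨y, hxy⟩)
    simpa [Ideal.ofList_singleton, Ideal.mem_span_singleton, Dvd.dvd] using this
  · intro x y z hxy
    have hspan : Ideal.ofList [a, b] = Ideal.span {a, b} := by
      simp [Ideal.ofList, Set.insert_def]
    have := key 2 (by simp) x (by
      simpa [hspan, Ideal.mem_span_pair] using ⟨y, z, by linear_combination -hxy⟩)
    simp only [List.take_succ_cons, List.take_zero, hspan, Ideal.mem_span_pair] at this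
    obtain ⟨s, t, hst⟩ := this
    exact ⟨s, t, by linear_combination -hst⟩

/-- Exactness of the Buchsbaum–Eisenbud complex in homological degree one: every syzygy of the
signed submaximal Pfaffians is a combination of the columns of `M`. -/
lemma IsAlternating.exists_mulVec_eq {R : Type} [CommRing R] {n : ℕ}
    {M : Matrix (Fin (2 * n + 1)) (Fin (2 * n + 1)) R} (hM : IsAlternating M)
    (hgr : gradeGE (pfIdeal M) 3) {v : Fin (2 * n + 1) → R}
    (hv : (fun j : Fin (2 * n + 1) => (-1) ^ (j : ℕ) * subPf M j) ⬝ᵥ v = 0) :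
    ∃ w, M.mulVec w = v := by
  obtain ⟨hMp, hB⟩ := hM.pfaffian_identities
  set p : Fin (2 * n + 1) → R := fun j => (-1) ^ (j : ℕ) * subPf M j with hp
  have hI : pfIdeal M ≤ Ideal.span (Set.range p) := by
    rw [pfIdeal, Ideal.span_le]
    rintro _ ⟨j, rfl⟩
    have : subPf M j = (-1) ^ (j : ℕ) * p j := by
      simp [hp, ← mul_assoc, ← pow_add, ← two_mul]
    rw [this]
    exact Ideal.mul_mem_left _ _ (Ideal.subset_span ⟨j, rfl⟩)
  have hom₁ : ∀ x ∈ pfIdeal M, ∃ u, M.mulVec u = x • v := by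
    intro x hx
    have hle : Ideal.span (Set.range p) ≤
        (LinearMap.range M.mulVecLin).comap (LinearMap.toSpanSingleton R _ v) := by
      refine Submodule.span_le.mpr ?_
      rintro _ ⟨i, rfl⟩
      obtain ⟨B, -, hMB⟩ := hB i
      refine ⟨B.mulVec v, ?_⟩
      simp [hMB, Matrix.sub_mulVec, Matrix.smul_mulVec, Matrix.vecMulVec_mulVec, hv]
    simpa using hle (hI hx)
  have hom₂ : ∀ x ∈ pfIdeal M, ∀ w, M.mulVec w = 0 → ∃ t : R, x • w = t • p := by
    intro x hx w hw
    have hle : Ideal.span (Set.range p) ≤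
        (R ∙ p).comap (LinearMap.toSpanSingleton R _ w) := by
      refine Submodule.span_le.mpr ?_
      rintro _ ⟨i, rfl⟩
      obtain ⟨B, hBt, hMB⟩ := hB i
      have hBM : B * M = p i • (1 : Matrix _ _ R) - Matrix.vecMulVec p (Pi.single i 1) := by
        have := congrArg Matrix.transpose hMB
        simpa [hBt, hM.1, Matrix.transpose_mul, Matrix.transpose_vecMulVec] using this
      have h0 : (B * M).mulVec w = 0 := by rw [← Matrix.mulVec_mulVec, hw, Matrix.mulVec_zero]
      rw [hBM, Matrix.sub_mulVec, Matrix.smul_mulVec, Matrix.one_mulVec,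
        Matrix.vecMulVec_mulVec, sub_eq_zero] at h0
      exact Submodule.mem_span_singleton.mpr ⟨w i, by simpa using h0.symm⟩
    obtain ⟨t, ht⟩ := Submodule.mem_span_singleton.mp (hle (hI hx))
    exact ⟨t, by simpa using ht.symm⟩
  obtain ⟨a, ha, b, hb, c, hc, rega, regb, regc⟩ := exists_regular_of_gradeGE_three hgr
  have regbV : ∀ x y : Fin (2 * n + 1) → R, b • x = a • y → ∃ z, x = a • z := by
    intro x y hxy
    choose z hz using fun j => regb (x j) (y j) (congrFun hxy j)
    exact ⟨z, funext hz⟩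
  have cancelV : ∀ x y : Fin (2 * n + 1) → R, a • x = a • y → x = y := by
    intro x y hxy
    ext j
    refine sub_eq_zero.mp (rega _ ?_)
    have := congrFun hxy j
    simp only [Pi.smul_apply, smul_eq_mul] at this
    linear_combination this
  have injp : ∀ t s : R, t • p = s • p → t = s := by
    intro t s hts
    refine sub_eq_zero.mp (rega _ ?_)
    have hle : Ideal.span (Set.range p) ≤ LinearMap.ker (LinearMap.mul R R (t - s)) := by
      refine Submodule.span_le.mpr ?_
      rintro _ ⟨i, rfl⟩
      have := congrFun hts i
      simp only [Pi.smul_apply, smul_eq_mul] at this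
      simpa [sub_mul, sub_eq_zero] using this
    rw [mul_comm]
    exact hle (hI ha)
  have exact₂ : ∀ w, M.mulVec w = 0 → ∃ s : R, w = s • p := by
    intro w hw
    obtain ⟨t, ht⟩ := hom₂ a ha w hw
    obtain ⟨t', ht'⟩ := hom₂ b hb w hw
    have : b * t = a * t' := injp _ _ (by
      rw [mul_smul, mul_smul, ← ht, ← ht', smul_comm])
    obtain ⟨s, rfl⟩ := regb _ _ this
    exact ⟨s, cancelV _ _ (by rw [ht, mul_smul])⟩
  obtain ⟨u₁, hu₁⟩ := hom₁ a ha
  obtain ⟨u₂, hu₂⟩ := hom₁ b hb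
  obtain ⟨u₃, hu₃⟩ := hom₁ c hc
  have hker : ∀ (x y : R) (u u' : Fin (2 * n + 1) → R), M.mulVec u = x • v →
      M.mulVec u' = y • v → ∃ s : R, y • u - x • u' = s • p := by
    intro x y u u' hu hu'
    refine exact₂ _ ?_
    rw [Matrix.mulVec_sub, Matrix.mulVec_smul, Matrix.mulVec_smul, hu, hu', smul_comm, sub_self]
  obtain ⟨s₁₂, h₁₂⟩ := hker a b u₁ u₂ hu₁ hu₂
  obtain ⟨s₁₃, h₁₃⟩ := hker a c u₁ u₃ hu₁ hu₃
  obtain ⟨s₂₃, h₂₃⟩ := hker b c u₂ u₃ hu₂ hu₃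
  obtain ⟨α, β, rfl⟩ := regc s₁₂ (-s₂₃) s₁₃ (injp _ _ (by
    simp only [add_smul, mul_smul, neg_smul, smul_neg, ← h₁₂, ← h₁₃, ← h₂₃]
    module))
  obtain ⟨w, hw⟩ := regbV (u₁ - β • p) (u₂ + α • p) (by
    rw [← sub_eq_zero]
    rw [← sub_eq_zero] at h₁₂
    rw [← h₁₂]
    module)
  refine ⟨w, cancelV _ _ ?_⟩
  rw [← Matrix.mulVec_smul, ← hw, Matrix.mulVec_sub, Matrix.mulVec_smul, hMp, hu₁, smul_zero,
    sub_zero]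

/-- Let `R` be a commutative Noetherian ring, `n ≥ 1`, `M` a
`(2n+1)×(2n+1)` alternating matrix over `R` such that the ideal `Pf(M)` of submaximal
Pfaffians has grade 3, and let `i₀` be an index.  If `r·Pf_{i₀}(M) ∈ (Pf_j(M) : j ≠ i₀)`
then `r` lies in the ideal generated by the entries of the `i₀`-th row of `M`.  In
particular, if all entries of the `i₀`-th row of `M` lie in an ideal `J ⊆ R`, then
`((Pf_j(M) : j ≠ i₀) :_R Pf_{i₀}(M)) ⊆ J`. -/
theorem statement_12 (R : Type) [CommRing R] [IsNoetherianRing R] (n : ℕ) (hn : 1 ≤ n)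
    (M : Matrix (Fin (2 * n + 1)) (Fin (2 * n + 1)) R) (hM : IsAlternating M)
    (hgr : hasGrade (pfIdeal M) 3) (i₀ : Fin (2 * n + 1)) :
    (∀ r : R, r * subPf M i₀ ∈ Ideal.span {p | ∃ j ≠ i₀, p = subPf M j} →
      r ∈ Ideal.span (Set.range (M i₀))) ∧
    (∀ J : Ideal R, (∀ j, M i₀ j ∈ J) →
      ∀ r : R, r * subPf M i₀ ∈ Ideal.span {p | ∃ j ≠ i₀, p = subPf M j} → r ∈ J) := by
  have main : ∀ r : R, r * subPf M i₀ ∈ Ideal.span {p | ∃ j ≠ i₀, p = subPf M j} →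
      r ∈ Ideal.span (Set.range (M i₀)) := by
    intro r hr
    have hcomb : ∀ x ∈ Ideal.span {p | ∃ j ≠ i₀, p = subPf M j},
        ∃ v : Fin (2 * n + 1) → R, v i₀ = 0 ∧
          (fun j : Fin (2 * n + 1) => (-1) ^ (j : ℕ) * subPf M j) ⬝ᵥ v = x := by
      intro x hx
      induction hx using Submodule.span_induction with
      | mem x hx =>
        obtain ⟨j, hj, rfl⟩ := hx
        refine ⟨Pi.single j ((-1) ^ (j : ℕ)), by simp [hj.symm], ?_⟩
        rw [dotProduct_single, mul_right_comm, ← pow_add, ← two_mul]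
        simp
      | zero => exact ⟨0, by simp, by simp⟩
      | add x y _ _ hx hy =>
        obtain ⟨v, hv0, rfl⟩ := hx
        obtain ⟨w, hw0, rfl⟩ := hy
        exact ⟨v + w, by simp [hv0, hw0], dotProduct_add _ _ _⟩
      | smul c x _ hx =>
        obtain ⟨v, hv0, rfl⟩ := hx
        exact ⟨c • v, by simp [hv0], dotProduct_smul _ _ _⟩
    obtain ⟨v, hv0, hv⟩ := hcomb _ hr
    obtain ⟨w, hw⟩ := hM.exists_mulVec_eq hgr.1
      (v := Pi.single i₀ ((-1) ^ (i₀ : ℕ) * r) - v) (by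
        rw [dotProduct_sub, hv, dotProduct_single, sub_eq_zero,
          show (-1 : R) ^ (i₀ : ℕ) * subPf M i₀ * ((-1) ^ (i₀ : ℕ) * r) =
            (-1) ^ (2 * (i₀ : ℕ)) * (r * subPf M i₀) by ring]
        simp)
    have hi : (-1) ^ (i₀ : ℕ) * r = ∑ j, M i₀ j * w j := by
      simpa [hv0, Matrix.mulVec, dotProduct] using (congrFun hw i₀).symm
    have hmem : (-1) ^ (i₀ : ℕ) * r ∈ Ideal.span (Set.range (M i₀)) :=
      hi ▸ Ideal.sum_mem _ fun j _ => Ideal.mul_mem_right _ _ (Ideal.subset_span ⟨j, rfl⟩)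
    have := Ideal.mul_mem_left _ ((-1) ^ (i₀ : ℕ)) hmem
    rwa [← mul_assoc, ← pow_add, ← two_mul, pow_mul, neg_one_sq, one_pow, one_mul] at this
  refine ⟨main, fun J hJ r hr => Ideal.span_le.mpr ?_ (main r hr)⟩
  rintro _ ⟨j, rfl⟩
  exact hJ j

end
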